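/- For every natural number n, there is an isomorphism of ℂ-algebras ℂ ⊗_ℝ CLIF(ℝ^{2n+1}) ≅ M_{2ⁿ}(ℂ) × M_{2ⁿ}(ℂ), the product of two copies of the algebra of 2ⁿ×2ⁿ complex matrices. -/

import Mathlib

open scoped RealInnerProductSpace TensorProduct

/-- Matrices over a product of algebras are pairs of matrices. -/
noncomputable def Matrix.prodAlgEquiv (n R A B : Type*) [Fintype n] [DecidableEq n] [CommSemiring R]
    [Semiring A] [Semiring B] [Algebra R A] [Algebra R B] :
    Matrix n n (A × B) ≃ₐ[R] Matrix n n A × Matrix n n B :=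
  AlgEquiv.ofBijective
    ((AlgHom.fst R A B).mapMatrix.prod (AlgHom.snd R A B).mapMatrix)
    ⟨fun X Y h => by
      ext i j
      · exact congr_fun₂ (congr_arg Prod.fst h) i j
      · exact congr_fun₂ (congr_arg Prod.snd h) i j,
     fun Y => ⟨Matrix.of fun i j => (Y.1 i j, Y.2 i j), rfl⟩⟩

namespace CliffordAlgebra

section Hyperbolic

variable {R M : Type*} [CommRing R] [AddCommGroup M] [Module R M] (Q : QuadraticForm R M)

/-- The orthogonal sum of `Q` with the hyperbolic plane `(a, b) ↦ a * b`. -/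
def addHyperbolic : QuadraticForm R (M × R × R) :=
  Q.prod (QuadraticMap.linMulLin (LinearMap.fst R R R) (LinearMap.snd R R R))

theorem addHyperbolic_apply (x : M × R × R) :
    addHyperbolic Q x = Q x.1 + x.2.1 * x.2.2 := rfl

/-- The homomorphism sending `(m, a, b)` to `!![m, a; b, -m]`. -/
def hyperbolicToMatrix :
    CliffordAlgebra (addHyperbolic Q) →ₐ[R] Matrix (Fin 2) (Fin 2) (CliffordAlgebra Q) :=
  lift (addHyperbolic Q)
    ⟨{ toFun := fun x => !![ι Q x.1, algebraMap R _ x.2.1; algebraMap R _ x.2.2, -ι Q x.1]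
       map_add' := fun x y => by
        ext i j; fin_cases i <;> fin_cases j <;> simp [add_comm]
       map_smul' := fun r x => by
        ext i j; fin_cases i <;> fin_cases j <;> simp [Algebra.smul_def] },
     fun x => by
      ext i j
      fin_cases i <;> fin_cases j <;>
        simp [addHyperbolic_apply, Matrix.mul_apply, Fin.sum_univ_two, Algebra.commutes,
          Matrix.algebraMap_matrix_apply, ← map_mul, mul_comm, add_comm] ⟩

@[simp]
theorem hyperbolicToMatrix_ι (x : M × R × R) :
    hyperbolicToMatrix Q (ι _ x) =
      !![ι Q x.1, algebraMap R _ x.2.1; algebraMap R _ x.2.2, -ι Q x.1] :=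
  lift_ι_apply _ _ _

/-- The first isotropic basis vector of the hyperbolic plane. -/
def hypLeft : CliffordAlgebra (addHyperbolic Q) := ι _ (0, 1, 0)

/-- The second isotropic basis vector of the hyperbolic plane. -/
def hypRight : CliffordAlgebra (addHyperbolic Q) := ι _ (0, 0, 1)

local notation "e" => hypLeft Q
local notation "f" => hypRight Q

theorem hypLeft_mul_self : e * e = 0 := by
  simp [hypLeft, ι_sq_scalar, addHyperbolic_apply]

theorem hypRight_mul_self : f * f = 0 := by
  simp [hypRight, ι_sq_scalar, addHyperbolic_apply]

theorem hypLeft_mul_hypRight_add_swap : e * f + f * e = 1 := by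
  simp [hypLeft, hypRight, ι_mul_ι_add_swap, QuadraticMap.polar, addHyperbolic_apply]

theorem ι_mul_hypLeft (m : M) : ι (addHyperbolic Q) (m, 0, 0) * e = -(e * ι _ (m, 0, 0)) := by
  rw [eq_neg_iff_add_eq_zero]
  simp [hypLeft, ι_mul_ι_add_swap, QuadraticMap.polar, addHyperbolic_apply]

theorem ι_mul_hypRight (m : M) : ι (addHyperbolic Q) (m, 0, 0) * f = -(f * ι _ (m, 0, 0)) := by
  rw [eq_neg_iff_add_eq_zero]
  simp [hypRight, ι_mul_ι_add_swap, QuadraticMap.polar, addHyperbolic_apply]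

theorem hypLeft_mul_hypRight_mul_hypLeft : e * f * e = e := by
  linear_combination (norm := noncomm_ring)
    hypLeft_mul_hypRight_add_swap Q * e - f * hypLeft_mul_self Q

theorem hypRight_mul_hypLeft_mul_hypRight : f * e * f = f := by
  linear_combination (norm := noncomm_ring)
    hypLeft_mul_hypRight_add_swap Q * f - e * hypRight_mul_self Q

/-- The volume element of the hyperbolic plane. -/
def hypVolume : CliffordAlgebra (addHyperbolic Q) := e * f - f * e

local notation "u" => hypVolume Q

theorem hypVolume_mul_hypLeft : u * e = e := by
  rw [hypVolume, sub_mul, hypLeft_mul_hypRight_mul_hypLeft, mul_assoc, hypLeft_mul_self]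
  simp

theorem hypLeft_mul_hypVolume : e * u = -e := by
  rw [hypVolume, mul_sub, ← mul_assoc, ← mul_assoc, hypLeft_mul_hypRight_mul_hypLeft,
    hypLeft_mul_self]
  simp

theorem hypVolume_mul_hypRight : u * f = -f := by
  rw [hypVolume, sub_mul, hypRight_mul_hypLeft_mul_hypRight, mul_assoc, hypRight_mul_self]
  simp

theorem hypRight_mul_hypVolume : f * u = f := by
  rw [hypVolume, mul_sub, ← mul_assoc, ← mul_assoc, hypRight_mul_hypLeft_mul_hypRight,
    hypRight_mul_self]
  simp

theorem hypVolume_mul_self : u * u = 1 := by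
  conv_lhs => enter [2]; rw [hypVolume]
  rw [mul_sub, ← mul_assoc, ← mul_assoc, hypVolume_mul_hypLeft, hypVolume_mul_hypRight,
    neg_mul, sub_neg_eq_add, hypLeft_mul_hypRight_add_swap]

theorem ι_commute_hypVolume (m : M) : Commute (ι (addHyperbolic Q) (m, 0, 0)) u := by
  rw [commute_iff_eq, hypVolume]
  linear_combination (norm := noncomm_ring)
    ι_mul_hypLeft Q m * f - e * ι_mul_hypRight Q m - ι_mul_hypRight Q m * e
      + f * ι_mul_hypLeft Q m

/-- The embedding of `CliffordAlgebra Q` into the centralizer of the hyperbolic plane. -/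
def toCentralizer : CliffordAlgebra Q →ₐ[R] CliffordAlgebra (addHyperbolic Q) :=
  lift Q ⟨LinearMap.mulRight R u ∘ₗ ι (addHyperbolic Q) ∘ₗ LinearMap.inl R M (R × R), fun m => by
    have h := (ι_commute_hypVolume Q m).eq
    simp only [LinearMap.comp_apply, LinearMap.mulRight_apply, LinearMap.inl_apply,
      ← Prod.mk_zero_zero]
    rw [mul_assoc, ← mul_assoc u, ← h, mul_assoc, hypVolume_mul_self, mul_one, ι_sq_scalar]
    simp [addHyperbolic_apply]⟩

@[simp]
theorem toCentralizer_ι (m : M) : toCentralizer Q (ι Q m) = ι _ (m, 0, 0) * u :=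
  lift_ι_apply _ _ _

theorem toCentralizer_commute {y : CliffordAlgebra (addHyperbolic Q)}
    (hy : ∀ m, Commute (ι _ (m, 0, 0) * u) y) (x : CliffordAlgebra Q) :
    Commute (toCentralizer Q x) y := by
  induction x using CliffordAlgebra.induction with
  | algebraMap r => simpa using Algebra.commute_algebraMap_left r y
  | ι m => simpa using hy m
  | mul a b ha hb => simpa using ha.mul_left hb
  | add a b ha hb => simpa using ha.add_left hb

theorem toCentralizer_commute_hypLeft (x : CliffordAlgebra Q) :
    Commute (toCentralizer Q x) e := by
  refine toCentralizer_commute Q (fun m => ?_) x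
  rw [commute_iff_eq, mul_assoc, hypVolume_mul_hypLeft, ← mul_assoc, ← neg_neg (e * _),
    ← ι_mul_hypLeft, neg_mul, mul_assoc, hypLeft_mul_hypVolume, mul_neg, neg_neg]

theorem toCentralizer_commute_hypRight (x : CliffordAlgebra Q) :
    Commute (toCentralizer Q x) f := by
  refine toCentralizer_commute Q (fun m => ?_) x
  rw [commute_iff_eq, mul_assoc, hypVolume_mul_hypRight, ← mul_assoc, ← neg_neg (f * _),
    ← ι_mul_hypRight, neg_mul, mul_assoc, hypRight_mul_hypVolume, mul_neg]

/-- The matrix units of `CliffordAlgebra (addHyperbolic Q)` coming from the hyperbolic plane. -/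
def hypUnit : Matrix (Fin 2) (Fin 2) (CliffordAlgebra (addHyperbolic Q)) :=
  !![e * f, e; f, f * e]

theorem hypUnit_mul (i j k l : Fin 2) :
    hypUnit Q i j * hypUnit Q k l = if j = k then hypUnit Q i l else 0 := by
  have h₁ := hypLeft_mul_self Q
  have h₂ := hypRight_mul_self Q
  have h₃ := hypLeft_mul_hypRight_mul_hypLeft Q
  have h₄ := hypRight_mul_hypLeft_mul_hypRight Q
  have h₅ (x) : x * e * e = 0 := by rw [mul_assoc, h₁, mul_zero]
  have h₆ (x) : x * f * f = 0 := by rw [mul_assoc, h₂, mul_zero]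
  fin_cases i <;> fin_cases j <;> fin_cases k <;> fin_cases l <;>
    simp [hypUnit, ← mul_assoc, h₁, h₂, h₃, h₄, h₅, h₆]

theorem toCentralizer_commute_hypUnit (x : CliffordAlgebra Q) (i j : Fin 2) :
    Commute (toCentralizer Q x) (hypUnit Q i j) := by
  have he := toCentralizer_commute_hypLeft Q x
  have hf := toCentralizer_commute_hypRight Q x
  fin_cases i <;> fin_cases j <;> simp [hypUnit, he, hf, Commute.mul_right]

/-- The homomorphism inverse to `hyperbolicToMatrix`. -/
def matrixToHyperbolic :
    Matrix (Fin 2) (Fin 2) (CliffordAlgebra Q) →ₐ[R] CliffordAlgebra (addHyperbolic Q) :=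
  AlgHom.ofLinearMap
    { toFun := fun A => ∑ i, ∑ j, toCentralizer Q (A i j) * hypUnit Q i j
      map_add' := fun A B => by simp [add_mul, Finset.sum_add_distrib]
      map_smul' := fun r A => by simp }
    (by simp [hypUnit, Fin.sum_univ_two, hypLeft_mul_hypRight_add_swap])
    (fun A B => by
      have key (x y : CliffordAlgebra Q) (i j k l : Fin 2) :
          toCentralizer Q x * hypUnit Q i j * (toCentralizer Q y * hypUnit Q k l) =
            toCentralizer Q (x * y) * if j = k then hypUnit Q i l else 0 := by
        rw [← hypUnit_mul, map_mul, mul_assoc, mul_assoc,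
          ← mul_assoc (hypUnit Q i j), ← (toCentralizer_commute_hypUnit Q y i j).eq, mul_assoc]
      simp only [LinearMap.coe_mk, AddHom.coe_mk, Fin.sum_univ_two, mul_add, add_mul, key,
        Matrix.mul_apply, map_add]
      simp
      abel)

theorem matrixToHyperbolic_apply (A : Matrix (Fin 2) (Fin 2) (CliffordAlgebra Q)) :
    matrixToHyperbolic Q A = ∑ i, ∑ j, toCentralizer Q (A i j) * hypUnit Q i j := rfl

theorem matrixToHyperbolic_comp_hyperbolicToMatrix :
    (matrixToHyperbolic Q).comp (hyperbolicToMatrix Q) = AlgHom.id R _ := by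
  ext : 1
  refine LinearMap.ext fun x => ?_
  have hx : ι (addHyperbolic Q) x = ι _ (x.1, 0, 0) + x.2.1 • e + x.2.2 • f := by
    simp only [hypLeft, hypRight, ← map_smul, ← map_add]
    simp
  have hu : ι (addHyperbolic Q) (x.1, 0, 0) * u * (e * f) - ι _ (x.1, 0, 0) * u * (f * e) =
      ι _ (x.1, 0, 0) := by
    rw [← mul_sub, ← hypVolume, mul_assoc, hypVolume_mul_self, mul_one]
  simp [matrixToHyperbolic_apply, Fin.sum_univ_two, hypUnit, ← Algebra.smul_def]
  linear_combination (norm := abel) hu - hx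

theorem hyperbolicToMatrix_hypLeft : hyperbolicToMatrix Q e = !![0, 1; 0, 0] := by
  simp [hypLeft]

theorem hyperbolicToMatrix_hypRight : hyperbolicToMatrix Q f = !![0, 0; 1, 0] := by
  simp [hypRight]

theorem hyperbolicToMatrix_toCentralizer (x : CliffordAlgebra Q) :
    hyperbolicToMatrix Q (toCentralizer Q x) = Matrix.diagonal fun _ => x := by
  induction x using CliffordAlgebra.induction with
  | algebraMap r => simp [Matrix.algebraMap_eq_diagonal, Pi.algebraMap_def]
  | ι m =>
    ext i j
    fin_cases i <;> fin_cases j <;>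
      simp [hypVolume, hyperbolicToMatrix_hypLeft, hyperbolicToMatrix_hypRight]
  | mul a b ha hb => simp [ha, hb]
  | add a b ha hb => simp [ha, hb]

theorem hyperbolicToMatrix_comp_matrixToHyperbolic :
    (hyperbolicToMatrix Q).comp (matrixToHyperbolic Q) = AlgHom.id R _ := by
  ext A i j : 3
  fin_cases i <;> fin_cases j <;>
    simp [matrixToHyperbolic_apply, Fin.sum_univ_two, hypUnit, hyperbolicToMatrix_toCentralizer,
      hyperbolicToMatrix_hypLeft, hyperbolicToMatrix_hypRight, Matrix.mul_apply]

/-- Adding a hyperbolic plane replaces a Clifford algebra by its algebra of `2 × 2` matrices. -/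
def addHyperbolicEquiv :
    CliffordAlgebra (addHyperbolic Q) ≃ₐ[R] Matrix (Fin 2) (Fin 2) (CliffordAlgebra Q) :=
  AlgEquiv.ofAlgHom (hyperbolicToMatrix Q) (matrixToHyperbolic Q)
    (hyperbolicToMatrix_comp_matrixToHyperbolic Q) (matrixToHyperbolic_comp_hyperbolicToMatrix Q)

end Hyperbolic
/-- The form `-∑ xᵢ²` on `ℂᵏ`. -/
noncomputable abbrev negSumSq (k : ℕ) : QuadraticForm ℂ (Fin k → ℂ) :=
  QuadraticMap.weightedSumSquares ℂ fun _ => (-1 : ℂ)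

/-- The Clifford algebra of a complex line. -/
theorem nonempty_negSumSq_one_equiv :
    Nonempty (CliffordAlgebra (negSumSq 1) ≃ₐ[ℂ] ℂ × ℂ) := by
  let v : CliffordAlgebra (negSumSq 1) := Complex.I • ι _ 1
  have hv : v * v = 1 := by
    simp [v, ι_sq_scalar, smul_smul]
  let F : CliffordAlgebra (negSumSq 1) →ₐ[ℂ] ℂ × ℂ :=
    lift _ ⟨((-Complex.I) • LinearMap.proj 0).prod (Complex.I • LinearMap.proj 0), fun x => by
      have h : Complex.I * x 0 * (Complex.I * x 0) = -(x 0 * x 0) := by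
        linear_combination x 0 * x 0 * Complex.I_mul_I
      ext <;> simp [h]⟩
  have hF : F v = (1, -1) := by
    have h : F (ι _ 1) = (-Complex.I, Complex.I) := by
      rw [lift_ι_apply]; simp
    rw [map_smul, h]
    simp
  let p : CliffordAlgebra (negSumSq 1) := (1 / 2 : ℂ) • (1 + v)
  let q : CliffordAlgebra (negSumSq 1) := (1 / 2 : ℂ) • (1 - v)
  have hp : p * p = p := by
    simp only [p, smul_mul_smul_comm, add_mul, mul_add, hv, one_mul, mul_one]
    module
  have hq : q * q = q := by
    simp only [q, smul_mul_smul_comm, sub_mul, mul_sub, hv, one_mul, mul_one]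
    module
  have hpq : p * q = 0 := by
    simp only [p, q, smul_mul_smul_comm, add_mul, mul_sub, hv, one_mul, mul_one]
    module
  have hqp : q * p = 0 := by
    simp only [p, q, smul_mul_smul_comm, sub_mul, mul_add, hv, one_mul, mul_one]
    module
  let G : ℂ × ℂ →ₐ[ℂ] CliffordAlgebra (negSumSq 1) :=
    AlgHom.ofLinearMap
      ((LinearMap.toSpanSingleton ℂ _ p).coprod (LinearMap.toSpanSingleton ℂ _ q))
      (by simp [p, q]; module)
      (fun x y => by simp [add_mul, mul_add, smul_smul, hp, hq, hpq, hqp, mul_comm])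
  refine ⟨AlgEquiv.ofAlgHom F G ?_ ?_⟩
  · refine AlgHom.ext fun x => ?_
    have hFp : F p = (1, 0) := by rw [map_smul, map_add, map_one, hF]; ext <;> norm_num
    have hFq : F q = (0, 1) := by rw [map_smul, map_sub, map_one, hF]; ext <;> norm_num
    simp [G, hFp, hFq]
  · ext : 1
    refine LinearMap.ext fun x => ?_
    have hx : x = x 0 • 1 := by ext i; fin_cases i; simp
    have hι : ι (negSumSq 1) 1 = (-Complex.I) • v := by simp [v, smul_smul]
    rw [hx]
    simp only [AlgHom.comp_toLinearMap, LinearMap.comp_apply, map_smul, hι]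
    congr 2
    simp [hF, G, p, q]
    module

/-- The last coordinates together with the two isotropic combinations of the first two. -/
noncomputable def negSumSqSplit (k : ℕ) :
    (Fin (k + 2) → ℂ) ≃ₗ[ℂ] (Fin k → ℂ) × ℂ × ℂ where
  toFun x := (fun i => x i.succ.succ, -(x 0 + Complex.I * x 1), x 0 - Complex.I * x 1)
  invFun y := Fin.cons ((y.2.2 - y.2.1) / 2)
    (Fin.cons (Complex.I * (y.2.1 + y.2.2) / 2) y.1)
  map_add' x y := by ext <;> simp <;> ring
  map_smul' r x := by ext <;> simp <;> ring
  left_inv x := by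
    ext i
    refine Fin.cases ?_ (fun i => Fin.cases ?_ (fun i => ?_) i) i
    · simp; ring
    · simp
      linear_combination (-x 1) * Complex.I_mul_I
    · simp
  right_inv y := by
    ext
    · simp
    · simp
      linear_combination (-(y.2.1 + y.2.2) / 2) * Complex.I_mul_I
    · simp
      linear_combination (-(y.2.1 + y.2.2) / 2) * Complex.I_mul_I

theorem baseChange_eq_comp {k : ℕ} (Q : QuadraticForm ℝ (EuclideanSpace ℝ (Fin k)))
    (hQ : ∀ x, Q x = -⟪x, x⟫) :
    Q.baseChange ℂ = (negSumSq k).comp ((Algebra.TensorProduct.basis ℂ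
      (EuclideanSpace.basisFun (Fin k) ℝ).toBasis).equivFun : _ →ₗ[ℂ] _) := by
  refine baseChange_ext fun m => ?_
  simp [QuadraticForm.baseChange_tmul, hQ, QuadraticMap.weightedSumSquares_apply,
    ← sq, ← Complex.ofReal_pow, EuclideanSpace.real_norm_sq_eq]

/-- Splitting off two coordinates is an isometry onto a sum with a hyperbolic plane. -/
noncomputable def negSumSqIsometry (k : ℕ) :
    (negSumSq (k + 2)).IsometryEquiv (addHyperbolic (negSumSq k)) where
  toLinearEquiv := negSumSqSplit k
  map_app' x := by
    simp [negSumSqSplit, addHyperbolic_apply, QuadraticMap.weightedSumSquares_apply,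
      Fin.sum_univ_succ]
    linear_combination (x 1 * x 1) * Complex.I_mul_I

theorem nonempty_negSumSq_odd_equiv (n : ℕ) :
    Nonempty (CliffordAlgebra (negSumSq (2 * n + 1)) ≃ₐ[ℂ]
      Matrix (Fin (2 ^ n)) (Fin (2 ^ n)) ℂ × Matrix (Fin (2 ^ n)) (Fin (2 ^ n)) ℂ) := by
  induction n with
  | zero =>
    obtain ⟨E⟩ := nonempty_negSumSq_one_equiv
    have : Unique (Fin (2 ^ 0)) := inferInstanceAs (Unique (Fin 1))
    let U : ℂ ≃ₐ[ℂ] Matrix (Fin (2 ^ 0)) (Fin (2 ^ 0)) ℂ :=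
      AlgEquiv.ofBijective (Algebra.ofId ℂ _) ⟨RingHom.injective _, fun A => ⟨A default default, by
        ext i j
        rw [Subsingleton.elim i default, Subsingleton.elim j default]
        simp [Algebra.ofId_apply, Matrix.algebraMap_matrix_apply]⟩⟩
    exact ⟨E.trans (AlgEquiv.prodCongr U U)⟩
  | succ n ih =>
    obtain ⟨E⟩ := ih
    let I := Fin (2 ^ n)
    let r : Fin 2 × I ≃ Fin (2 ^ (n + 1)) := finProdFinEquiv.trans (finCongr (pow_succ' 2 n).symm)
    let C : Matrix (Fin 2) (Fin 2) (Matrix I I ℂ) ≃ₐ[ℂ] Matrix (Fin (2 ^ (n + 1))) _ ℂ :=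
      (Matrix.compAlgEquiv (Fin 2) I ℂ ℂ).trans (Matrix.reindexAlgEquiv ℂ ℂ r)
    exact ⟨(equivOfIsometry (negSumSqIsometry (2 * n + 1))).trans <|
      (addHyperbolicEquiv _).trans <| E.mapMatrix.trans <|
      (Matrix.prodAlgEquiv (Fin 2) ℂ _ _).trans <| AlgEquiv.prodCongr C C⟩

end CliffordAlgebra

/-- `ℂ ⊗ CLIF(ℝ^{2n+1}) ≅ M_{2ⁿ}(ℂ) × M_{2ⁿ}(ℂ)` as `ℂ`-algebras, where
`CLIF(ℝᵐ)` is the Clifford algebra of the negative euclidean form `Q(x) = -‖x‖²`. -/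
theorem complexified_clifford_odd_dim (n : ℕ)
    (Q : ∀ m : ℕ, QuadraticForm ℝ (EuclideanSpace ℝ (Fin m)))
    (hQ : ∀ (m : ℕ) (x : EuclideanSpace ℝ (Fin m)), Q m x = -⟪x, x⟫) :
    Nonempty ((ℂ ⊗[ℝ] CliffordAlgebra (Q (2 * n + 1))) ≃ₐ[ℂ]
      (Matrix (Fin (2 ^ n)) (Fin (2 ^ n)) ℂ × Matrix (Fin (2 ^ n)) (Fin (2 ^ n)) ℂ)) := by
  let W := CliffordAlgebra.negSumSq (2 * n + 1)
  let b := (Algebra.TensorProduct.basis ℂ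
    (EuclideanSpace.basisFun (Fin (2 * n + 1)) ℝ).toBasis).equivFun
  have h := CliffordAlgebra.baseChange_eq_comp (Q (2 * n + 1)) (hQ _)
  let e : ((Q (2 * n + 1)).baseChange ℂ).IsometryEquiv W :=
    { b with map_app' := fun x => by rw [h]; rfl }
  obtain ⟨E⟩ := CliffordAlgebra.nonempty_negSumSq_odd_equiv n
  exact ⟨(CliffordAlgebra.equivBaseChange ℂ (Q (2 * n + 1))).symm.trans <|
    (CliffordAlgebra.equivOfIsometry e).trans E⟩
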